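/- Let 0 < β < n, 1 < p < q < ∞ with 1/q = 1/p - β/n. For a nonnegative measurable function f on ℝⁿ define ℍ_β(f)(x) = |B(0,|x|)|^{-(1-β/n)} ∫_{|y|<|x|} f(y) dy. Then ‖ℍ_β(f)‖_{L^q(ℝⁿ)} ≤ C ‖f‖_{L^p(ℝⁿ)}, where C = (p'/q)^{1/q} ((n/(qβ)) · B(n/(qβ), n/(q'β)))^{-β/n}, and this constant is sharp. -/

import Mathlib

open MeasureTheory Set
open scoped ENNReal

/-- The Euler Beta function `B(z,w) = ∫₀¹ t^(z-1) (1-t)^(w-1) dt`. -/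
noncomputable def betaFn (z w : ℝ) : ℝ :=
  ∫ t in Ioo (0 : ℝ) 1, t ^ (z - 1) * (1 - t) ^ (w - 1)

/-- The `n`-dimensional fractional Hardy operator with spherical mean:
`ℍ_β f x = |B(0,|x|)|^{-(1-β/n)} ∫_{|y|<|x|} f(y) dy`. -/
noncomputable def fracHardy (n : ℕ) (β : ℝ)
    (f : EuclideanSpace ℝ (Fin n) → ℝ≥0∞) (x : EuclideanSpace ℝ (Fin n)) : ℝ≥0∞ :=
  (volume (Metric.ball (0 : EuclideanSpace ℝ (Fin n)) ‖x‖)) ^ (β / (n : ℝ) - 1) *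
    ∫⁻ y in Metric.ball (0 : EuclideanSpace ℝ (Fin n)) ‖x‖, f y

section Auxiliary

open Filter Topology

theorem tendsto_measure_Iio_atTop_univ (m : Measure ℝ) :
    Filter.Tendsto (fun x => m (Iio x)) Filter.atTop (nhds (m univ)) := by
  rw [← iUnion_Iio]
  exact tendsto_measure_iUnion_atTop fun _ _ h => Iio_subset_Iio h

/-- The push-forward of an atomless finite measure under its distribution function is Lebesgue
measure. -/
theorem map_measureReal_Iio (m : Measure ℝ) [IsFiniteMeasure m]
    (hF : Continuous fun x => m.real (Iio x)) (h0 : m (Iio 0) = 0) :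
    m.map (fun x => m.real (Iio x)) = volume.restrict (Ioc 0 (m.real univ)) := by
  set F : ℝ → ℝ := fun x => m.real (Iio x) with hFdef
  have hFm : Measurable F := hF.measurable
  have hFmono : Monotone F := fun x y hxy => measureReal_mono (Iio_subset_Iio hxy)
  have hF0 : F 0 = 0 := by simp [hFdef, measureReal_def, h0]
  have hFM : ∀ x, F x ≤ m.real univ := fun x => measureReal_mono (subset_univ _)
  have htop : Tendsto F atTop (𝓝 (m.real univ)) :=
    (ENNReal.tendsto_toReal (measure_ne_top m univ)).comp (tendsto_measure_Iio_atTop_univ m)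
  have hivt : ∀ c, 0 ≤ c → c < m.real univ → ∃ t, F t = c := fun c hc hcM => by
    obtain ⟨t, ht⟩ := (htop.eventually (lt_mem_nhds hcM)).exists
    exact mem_range_of_exists_le_of_exists_ge hF ⟨0, hF0.trans_le hc⟩ ⟨t, ht.le⟩
  refine Measure.ext_of_Iic _ _ fun c => ?_
  have hlow : ∀ c, 0 ≤ c → c < m.real univ → ENNReal.ofReal c ≤ m (F ⁻¹' Iic c) :=
    fun c hc hcM => by
    obtain ⟨t, rfl⟩ := hivt c hc hcM
    rw [ofReal_measureReal]
    exact measure_mono fun x hx => hFmono (le_of_lt hx)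
  rw [Measure.map_apply hFm measurableSet_Iic, Measure.restrict_apply measurableSet_Iic]
  rcases le_or_gt (m.real univ) c with hMc | hcM
  · have h1 : F ⁻¹' Iic c = univ := eq_univ_of_forall fun x => (hFM x).trans hMc
    have h2 : Iic c ∩ Ioc 0 (m.real univ) = Ioc 0 (m.real univ) :=
      inter_eq_right.2 fun x hx => hx.2.trans hMc
    rw [h1, h2, Real.volume_Ioc, sub_zero, ofReal_measureReal]
  rcases lt_or_ge c 0 with hc | hc
  · have h1 : F ⁻¹' Iic c = ∅ := eq_empty_of_forall_notMem fun x hx =>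
      (hc.trans_le measureReal_nonneg).not_ge hx
    have h2 : Iic c ∩ Ioc 0 (m.real univ) = ∅ :=
      eq_empty_of_forall_notMem fun x hx => (hc.trans hx.2.1).not_ge hx.1
    rw [h1, h2, measure_empty, measure_empty]
  have h2 : Iic c ∩ Ioc 0 (m.real univ) = Ioc 0 c := by
    ext x
    simp only [mem_inter_iff, mem_Iic, mem_Ioc]
    constructor
    · rintro ⟨h, h', -⟩; exact ⟨h', h⟩
    · rintro ⟨h, h'⟩; exact ⟨h', h, h'.trans hcM.le⟩
  rw [h2, Real.volume_Ioc, sub_zero]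
  refine le_antisymm ?_ (hlow c hc hcM)
  refine ge_of_tendsto (x := 𝓝[>] c) (ENNReal.continuous_ofReal.continuousAt.tendsto.mono_left
    nhdsWithin_le_nhds) ?_
  filter_upwards [Ioo_mem_nhdsGT hcM] with d hd
  obtain ⟨t, rfl⟩ := hivt d (hc.trans hd.1.le) hd.2
  rw [ofReal_measureReal]
  exact measure_mono fun x hx => not_le.1 fun h => (hd.1.trans_le (hFmono h)).not_ge hx

theorem lintegral_Iio_measureReal_rpow (m : Measure ℝ) [IsFiniteMeasure m]
    (hF : Continuous fun x => m.real (Iio x)) (h0 : m (Iio 0) = 0) {b : ℝ} (hb : 0 < b) (s : ℝ) :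
    ∫⁻ t in Iio s, ENNReal.ofReal (m.real (Iio t) ^ b) ∂m
      = ENNReal.ofReal (m.real (Iio s) ^ (b + 1) / (b + 1)) := by
  have hG : ∀ x, (m.restrict (Iio s)).real (Iio x) = m.real (Iio (min x s)) := fun x => by
    rw [measureReal_restrict_apply measurableSet_Iio, Iio_inter_Iio]
  have hGc : Continuous fun x => (m.restrict (Iio s)).real (Iio x) := by
    simp only [hG]
    exact hF.comp (continuous_id.min continuous_const)
  have hG0 : (m.restrict (Iio s)) (Iio 0) = 0 :=
    le_antisymm ((Measure.restrict_apply_le _ _).trans h0.le) zero_le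
  have key := map_measureReal_Iio (m.restrict (Iio s)) hGc hG0
  have hmeas : Measurable fun y : ℝ => ENNReal.ofReal (y ^ b) := by fun_prop
  calc ∫⁻ t in Iio s, ENNReal.ofReal (m.real (Iio t) ^ b) ∂m
      = ∫⁻ t in Iio s, ENNReal.ofReal ((m.restrict (Iio s)).real (Iio t) ^ b) ∂m := by
        refine setLIntegral_congr_fun measurableSet_Iio fun t ht => ?_
        simp only [hG, min_eq_left (le_of_lt (mem_Iio.1 ht))]
    _ = ∫⁻ y in Ioc 0 (m.real (Iio s)), ENNReal.ofReal (y ^ b) := by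
        rw [← lintegral_map hmeas hGc.measurable, key, measureReal_restrict_apply_univ]
    _ = _ := by
        have h : 0 ≤ m.real (Iio s) := measureReal_nonneg
        rw [← ofReal_integral_eq_lintegral_ofReal, ← intervalIntegral.integral_of_le h,
          integral_rpow (Or.inl (by linarith)), Real.zero_rpow (by positivity), sub_zero]
        · exact (intervalIntegrable_iff_integrableOn_Ioc_of_le h).1
            (intervalIntegral.intervalIntegrable_rpow' (by linarith))
        · filter_upwards [ae_restrict_mem measurableSet_Ioc] with y hy
          exact Real.rpow_nonneg hy.1.le _

section Transport

variable {w : ℝ → ℝ}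

theorem hasDerivAt_primitive_of_continuousOn_Ioi (hwc : ContinuousOn w (Ioi 0))
    (hwi : IntegrableOn w (Ioi 0)) {s : ℝ} (hs : 0 < s) :
    HasDerivAt (fun s => ∫ u in (0 : ℝ)..s, w u) (w s) s :=
  intervalIntegral.integral_hasDerivAt_right
    ((intervalIntegrable_iff_integrableOn_Ioc_of_le hs.le).2
      (hwi.mono_set fun _ hx => hx.1))
    (hwc.stronglyMeasurableAtFilter isOpen_Ioi s hs) (hwc.continuousAt (Ioi_mem_nhds hs))

theorem monotoneOn_primitive (hw0 : ∀ s, 0 < s → 0 ≤ w s) (hwi : IntegrableOn w (Ioi 0)) :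
    MonotoneOn (fun s => ∫ u in (0 : ℝ)..s, w u) (Ici 0) := by
  intro a ha b hb hab
  simp only [intervalIntegral.integral_of_le (mem_Ici.1 ha),
    intervalIntegral.integral_of_le (mem_Ici.1 hb)]
  refine setIntegral_mono_set (hwi.mono_set fun _ hx => hx.1) ?_
    (Ioc_subset_Ioc_right hab).eventuallyLE
  filter_upwards [ae_restrict_mem measurableSet_Ioc] with x hx using hw0 x hx.1

theorem strictMonoOn_primitive (hwc : ContinuousOn w (Ioi 0))
    (hwi : IntegrableOn w (Ioi 0)) (hup : ∀ s t, 0 < s → s ≤ t → 0 < w s → 0 < w t) :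
    StrictMonoOn (fun s => ∫ u in (0 : ℝ)..s, w u) {s | 0 < s ∧ 0 < w s} := by
  have hconv : Convex ℝ {s | 0 < s ∧ 0 < w s} := by
    refine OrdConnected.convex ⟨fun x hx y _ z hz => ⟨hx.1.trans_le hz.1, hup x z hx.1 hz.1 hx.2⟩⟩
  refine strictMonoOn_of_hasDerivWithinAt_pos hconv (f' := w)
    (fun s hs => (hasDerivAt_primitive_of_continuousOn_Ioi hwc hwi
      hs.1).continuousAt.continuousWithinAt)
    (fun s hs => (hasDerivAt_primitive_of_continuousOn_Ioi hwc hwi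
      (interior_subset hs).1).hasDerivWithinAt) fun s hs => (interior_subset hs).2

theorem image_primitive (hw0 : ∀ s, 0 < s → 0 ≤ w s) (hwc : ContinuousOn w (Ioi 0))
    (hwi : IntegrableOn w (Ioi 0)) (hup : ∀ s t, 0 < s → s ≤ t → 0 < w s → 0 < w t) :
    (fun s => ∫ u in (0 : ℝ)..s, w u) '' {s | 0 < s ∧ 0 < w s}
      = Ioo 0 (∫ u in Ioi (0 : ℝ), w u) := by
  have hmono := monotoneOn_primitive hw0 hwi
  have hstrict := strictMonoOn_primitive hwc hwi hup
  have hlim : Tendsto (fun s => ∫ u in (0 : ℝ)..s, w u) atTop (𝓝 (∫ u in Ioi (0 : ℝ), w u)) :=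
    intervalIntegral_tendsto_integral_Ioi 0 hwi tendsto_id
  have h0 : (fun s => ∫ u in (0 : ℝ)..s, w u) 0 = 0 := by simp
  set P : ℝ → ℝ := fun s => ∫ u in (0 : ℝ)..s, w u with hP
  ext y
  constructor
  · rintro ⟨s, hs, rfl⟩
    constructor
    · have hopen : {s | 0 < s ∧ 0 < w s} ∈ 𝓝 s :=
        (hwc.isOpen_inter_preimage isOpen_Ioi isOpen_Ioi).mem_nhds hs
      obtain ⟨l, hl, hlU⟩ := exists_Ioc_subset_of_mem_nhds hopen ⟨s - 1, by linarith⟩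
      have hmem : (l + s) / 2 ∈ {s | 0 < s ∧ 0 < w s} := hlU ⟨by linarith, by linarith⟩
      calc (0 : ℝ) = P 0 := h0.symm
        _ ≤ P ((l + s) / 2) := hmono self_mem_Ici hmem.1.le hmem.1.le
        _ < P s := hstrict hmem hs (by linarith)
    · have h1 : s + 1 ∈ {s | 0 < s ∧ 0 < w s} :=
        ⟨by linarith [hs.1], hup s _ hs.1 (by linarith) hs.2⟩
      refine (hstrict hs h1 (by linarith)).trans_le (ge_of_tendsto hlim ?_)
      filter_upwards [eventually_ge_atTop (s + 1)] with t ht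
      exact hmono h1.1.le (h1.1.le.trans ht) ht
  · rintro ⟨hy0, hyM⟩
    obtain ⟨b, hb, hb0⟩ := ((hlim.eventually (lt_mem_nhds hyM)).and (eventually_ge_atTop 0)).exists
    have hcont : ContinuousOn P (Icc 0 b) := by
      have := intervalIntegral.continuousOn_primitive_interval (μ := volume) (f := w) (a := 0)
        (b := b) ?_
      · rwa [uIcc_of_le hb0] at this
      · rw [uIcc_of_le hb0, integrableOn_Icc_iff_integrableOn_Ioc]
        exact hwi.mono_set fun _ hx => hx.1
    obtain ⟨s, hs, hsy⟩ := intermediate_value_Icc hb0 hcont ⟨h0.trans_le hy0.le, hb.le⟩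
    have hs0 : 0 < s := hs.1.lt_of_ne fun h => by
      rw [← h, h0] at hsy; exact hy0.ne hsy
    refine ⟨s, ⟨hs0, (hw0 s hs0).lt_of_ne fun h => ?_⟩, hsy⟩
    have hz : P s = 0 := by
      simp only [hP, intervalIntegral.integral_of_le hs0.le]
      refine setIntegral_eq_zero_of_forall_eq_zero fun x hx => ?_
      by_contra hne
      exact (hup x s hx.1 hx.2 ((hw0 x hx.1).lt_of_ne' hne)).ne h
    rw [hz] at hsy
    exact hy0.ne hsy

/-- The monotone transport between two densities on the half-line. -/
theorem exists_monotone_transport (hw0 : ∀ s, 0 < s → 0 ≤ w s) (hwc : ContinuousOn w (Ioi 0))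
    (hwi : IntegrableOn w (Ioi 0)) (hup : ∀ s t, 0 < s → s ≤ t → 0 < w s → 0 < w t)
    (hM : 0 < ∫ u in Ioi (0 : ℝ), w u) {v : ℝ → ℝ} (hv0 : ∀ s, 0 < s → 0 < v s)
    (hvc : ContinuousOn v (Ioi 0)) (hvi : IntegrableOn v (Ioi 0))
    (hN : 0 < ∫ u in Ioi (0 : ℝ), v u) :
    ∃ T : ℝ → ℝ, (∀ s ∈ {s | 0 < s ∧ 0 < w s}, 0 < T s ∧ HasDerivAt T
        ((∫ u in Ioi (0 : ℝ), v u) / (∫ u in Ioi (0 : ℝ), w u) * w s / v (T s)) s) ∧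
      MonotoneOn T {s | 0 < s ∧ 0 < w s} ∧ T '' {s | 0 < s ∧ 0 < w s} = Ioi 0 := by
  have hU : {s | 0 < s ∧ 0 < v s} = Ioi 0 := by
    ext s; exact ⟨fun h => h.1, fun h => ⟨h, hv0 s h⟩⟩
  have hvup : ∀ s t, 0 < s → s ≤ t → 0 < v s → 0 < v t := fun s t hs hst _ =>
    hv0 t (hs.trans_le hst)
  have hHs := strictMonoOn_primitive hvc hvi hvup
  have hHi := image_primitive (fun s hs => (hv0 s hs).le) hvc hvi hvup
  rw [hU] at hHs hHi
  have hPs := strictMonoOn_primitive hwc hwi hup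
  have hPi := image_primitive hw0 hwc hwi hup
  have hPd := fun s hs => hasDerivAt_primitive_of_continuousOn_Ioi hwc hwi (s := s) hs
  have hHd := fun s hs => hasDerivAt_primitive_of_continuousOn_Ioi hvc hvi (s := s) hs
  set N := ∫ u in Ioi (0 : ℝ), v u
  set M := ∫ u in Ioi (0 : ℝ), w u
  set H : ℝ → ℝ := fun s => ∫ u in (0 : ℝ)..s, v u
  set P : ℝ → ℝ := fun s => ∫ u in (0 : ℝ)..s, w u
  set U := {s | 0 < s ∧ 0 < w s}
  set S := Function.invFunOn H (Ioi 0)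
  have hS : ∀ y ∈ Ioo 0 N, 0 < S y ∧ H (S y) = y := fun y hy => by
    rw [← hHi] at hy
    exact ⟨Function.invFunOn_mem hy, Function.invFunOn_eq hy⟩
  have hSH : ∀ t, 0 < t → S (H t) = t := fun t ht => by
    have hy := hHi.subset (mem_image_of_mem H ht)
    exact hHs.injOn (hS _ hy).1 ht (hS _ hy).2
  have hSmono : StrictMonoOn S (Ioo 0 N) := fun x hx y hy hxy => by
    refine (hHs.lt_iff_lt (hS x hx).1 (hS y hy).1).1 ?_
    rwa [(hS x hx).2, (hS y hy).2]
  have hSi : S '' Ioo 0 N = Ioi 0 := by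
    ext t
    constructor
    · rintro ⟨y, hy, rfl⟩; exact (hS y hy).1
    · exact fun ht => ⟨H t, hHi.subset (mem_image_of_mem H ht), hSH t ht⟩
  have hSd : ∀ y ∈ Ioo 0 N, HasDerivAt S (v (S y))⁻¹ y := fun y hy => by
    have hc : ContinuousAt S y := hSmono.continuousAt_of_image_mem_nhds
      (Ioo_mem_nhds hy.1 hy.2) (by rw [hSi]; exact Ioi_mem_nhds (hS y hy).1)
    refine HasDerivAt.of_local_left_inverse hc (hHd _ (hS y hy).1) (hv0 _ (hS y hy).1).ne' ?_
    filter_upwards [Ioo_mem_nhds hy.1 hy.2] with z hz using (hS z hz).2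
  have hscale : (fun x => N / M * x) '' Ioo 0 M = Ioo 0 N := by
    rw [image_mul_left_Ioo (div_pos hN hM), mul_zero, div_mul_cancel₀ _ hM.ne']
  have hin : ∀ s ∈ U, N / M * P s ∈ Ioo 0 N := fun s hs => by
    rw [← hscale]
    exact mem_image_of_mem _ (hPi.subset (mem_image_of_mem P hs))
  refine ⟨fun s => S (N / M * P s), fun s hs => ⟨(hS _ (hin s hs)).1, ?_⟩, ?_, ?_⟩
  · refine ((hSd _ (hin s hs)).comp s ((hPd s hs.1).const_mul (N / M))).congr_deriv ?_
    rw [div_eq_mul_inv (_ * _), mul_comm]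
  · exact fun x hx y hy hxy => hSmono.monotoneOn (hin x hx) (hin y hy)
      (mul_le_mul_of_nonneg_left (hPs.monotoneOn hx hy hxy) (div_pos hN hM).le)
  · rw [← hSi, ← hscale, ← hPi, image_image, image_image]

end Transport

theorem integrableOn_Ioi_of_le_rpow {h : ℝ → ℝ} (hc : ContinuousOn h (Ioi 0))
    (h0 : ∀ s, 0 < s → 0 ≤ h s) {α δ C D : ℝ} (hα : -1 < α) (hδ : δ < -1)
    (hC : ∀ s, 0 < s → s ≤ 1 → h s ≤ C * s ^ α) (hD : ∀ s, 1 ≤ s → h s ≤ D * s ^ δ) :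
    IntegrableOn h (Ioi 0) := by
  rw [← Ioc_union_Ioi_eq_Ioi (zero_le_one' ℝ)]
  refine IntegrableOn.union ?_ ?_
  · have hi : IntegrableOn (fun s : ℝ => C * s ^ α) (Ioc 0 1) :=
      ((intervalIntegrable_iff_integrableOn_Ioc_of_le zero_le_one).1
        (intervalIntegral.intervalIntegrable_rpow' hα)).const_mul C
    refine Integrable.mono' hi
      ((hc.mono fun s hs => hs.1).aestronglyMeasurable measurableSet_Ioc) ?_
    filter_upwards [ae_restrict_mem measurableSet_Ioc] with s hs
    rw [Real.norm_of_nonneg (h0 s hs.1)]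
    exact hC s hs.1 hs.2
  · have hi : IntegrableOn (fun s : ℝ => D * s ^ δ) (Ioi 1) :=
      (integrableOn_Ioi_rpow_of_lt hδ one_pos).const_mul D
    refine Integrable.mono' hi
      ((hc.mono (Ioi_subset_Ioi zero_le_one)).aestronglyMeasurable measurableSet_Ioi) ?_
    filter_upwards [ae_restrict_mem measurableSet_Ioi] with s hs
    rw [Real.norm_of_nonneg (h0 s (zero_lt_one.trans (mem_Ioi.1 hs)))]
    exact hD s (le_of_lt hs)

section Extremal

variable {r b : ℝ}

theorem one_add_rpow_rpow_neg_le {t r e : ℝ} (hr : 0 < r) (ht : 0 < t) (he : 0 ≤ e) :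
    (1 + t ^ r) ^ (-(e / r)) ≤ t ^ (-e) := by
  have h : (t ^ r) ^ (-(e / r)) = t ^ (-e) := by
    rw [← Real.rpow_mul ht.le]; congr 1; field_simp
  rw [← h]
  exact Real.rpow_le_rpow_of_nonpos (by positivity) (by linarith)
    (neg_nonpos.2 (by positivity))

theorem continuousOn_one_add_rpow_rpow (r e : ℝ) :
    ContinuousOn (fun t : ℝ => (1 + t ^ r) ^ e) (Ioi 0) := by
  intro t ht
  have ht' : 0 < t := ht
  have : 0 < t ^ r := Real.rpow_pos_of_pos ht r
  exact ((continuousAt_const.add (Real.continuousAt_rpow_const t r (Or.inl ht'.ne'))).rpow_const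
    (Or.inl (by simp only [Pi.add_apply]; positivity))).continuousWithinAt

theorem integrableOn_one_add_rpow_rpow (hr : 0 < r) {e : ℝ} (he : 1 < e) :
    IntegrableOn (fun t : ℝ => (1 + t ^ r) ^ (-(e / r))) (Ioi 0) := by
  refine integrableOn_Ioi_of_le_rpow (α := 0) (δ := -e) (C := 1) (D := 1)
    (continuousOn_one_add_rpow_rpow r _) (fun s hs => by positivity) (by norm_num) (by linarith)
    (fun s hs _ => ?_) (fun s hs => ?_)
  · rw [Real.rpow_zero, mul_one]
    exact Real.rpow_le_one_of_one_le_of_nonpos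
      (by have := Real.rpow_nonneg hs.le r; linarith) (neg_nonpos.2 (by positivity))
  · rw [one_mul]
    exact one_add_rpow_rpow_neg_le hr (by linarith) (by linarith)

theorem integrableOn_rpow_mul_one_add_rpow_rpow (hr : 0 < r) {e : ℝ} (he : r + 1 < e) :
    IntegrableOn (fun t : ℝ => t ^ r * (1 + t ^ r) ^ (-(e / r))) (Ioi 0) := by
  have he0 : 0 < e := by linarith
  refine integrableOn_Ioi_of_le_rpow (α := r) (δ := r - e) (C := 1) (D := 1)
    ((continuousOn_id.rpow_const fun t ht => Or.inl (ne_of_gt ht)).mul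
      (continuousOn_one_add_rpow_rpow r _)) (fun s hs => by positivity) (by linarith) (by linarith)
    (fun s hs _ => ?_) (fun s hs => ?_)
  · rw [one_mul]
    exact mul_le_of_le_one_right (by positivity) (Real.rpow_le_one_of_one_le_of_nonpos
      (by have := Real.rpow_nonneg hs.le r; linarith) (neg_nonpos.2 (by positivity)))
  · have hs' : 0 < s := by linarith
    rw [one_mul, sub_eq_add_neg, Real.rpow_add hs']
    exact mul_le_mul_of_nonneg_left (one_add_rpow_rpow_neg_le hr hs' (by linarith))
      (by positivity)

theorem hasDerivAt_mul_one_add_rpow_rpow {t : ℝ} (ht : 0 < t) (hr : 0 < r) (e : ℝ) :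
    HasDerivAt (fun t : ℝ => t * (1 + t ^ r) ^ (-(e / r)))
      ((1 + t ^ r) ^ (-((e + r) / r)) - (e - 1) * (t ^ r * (1 + t ^ r) ^ (-((e + r) / r)))) t := by
  have hp : 0 < 1 + t ^ r := by positivity
  have h1 : HasDerivAt (fun t : ℝ => 1 + t ^ r) (r * t ^ (r - 1)) t :=
    (Real.hasDerivAt_rpow_const (Or.inl ht.ne')).const_add 1
  refine ((hasDerivAt_id t).mul (h1.rpow_const (p := -(e / r)) (Or.inl hp.ne'))).congr_deriv ?_
  have h2 : (1 + t ^ r) ^ (-(e / r)) = (1 + t ^ r) * (1 + t ^ r) ^ (-((e + r) / r)) := by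
    nth_rewrite 2 [← Real.rpow_one (1 + t ^ r)]
    rw [← Real.rpow_add hp]
    congr 1; field_simp; ring
  have h3 : -(e / r) - 1 = -((e + r) / r) := by field_simp; ring
  have h4 : t * t ^ (r - 1) = t ^ r := by
    rw [← Real.rpow_one_add' ht.le (by linarith [hr.ne'] : 1 + (r - 1) ≠ 0)]; congr 1; ring
  simp only [id, one_mul, h3]
  rw [h2]
  have : t * (r * t ^ (r - 1) * -(e / r) * (1 + t ^ r) ^ (-((e + r) / r)))
    = (t * t ^ (r - 1)) * -e * (1 + t ^ r) ^ (-((e + r) / r)) := by field_simp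
  rw [this, h4]; ring

theorem integral_one_add_rpow_rpow (hr : 0 < r) (hb : 0 < b) :
    ∫ t in Ioi (0 : ℝ), (1 + t ^ r) ^ (-((b + 1 + r) / r))
      = b * ∫ t in Ioi (0 : ℝ), t ^ r * (1 + t ^ r) ^ (-((b + 1 + r) / r)) := by
  have i1 := integrableOn_one_add_rpow_rpow hr (e := b + 1 + r) (by linarith)
  have i2 := (integrableOn_rpow_mul_one_add_rpow_rpow hr (e := b + 1 + r) (by linarith)).const_mul b
  have hcont : ContinuousWithinAt (fun t : ℝ => t * (1 + t ^ r) ^ (-((b + 1) / r))) (Ici 0) 0 := by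
    refine ContinuousAt.continuousWithinAt ?_
    refine continuousAt_id.mul ((continuousAt_const.add
      (Real.continuousAt_rpow_const 0 r (Or.inr hr.le))).rpow_const (Or.inl ?_))
    simp [Real.zero_rpow hr.ne']
  have hlim : Tendsto (fun t : ℝ => t * (1 + t ^ r) ^ (-((b + 1) / r))) atTop (𝓝 0) := by
    refine tendsto_of_tendsto_of_tendsto_of_le_of_le' tendsto_const_nhds
      (tendsto_rpow_neg_atTop hb) ?_ ?_
    · filter_upwards [eventually_gt_atTop 0] with t ht
      positivity
    · filter_upwards [eventually_gt_atTop 0] with t ht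
      calc t * (1 + t ^ r) ^ (-((b + 1) / r)) ≤ t * t ^ (-(b + 1)) :=
            mul_le_mul_of_nonneg_left (one_add_rpow_rpow_neg_le hr ht (by linarith)) ht.le
        _ = t ^ (-b) := by
            rw [← Real.rpow_one_add' ht.le (by linarith)]; congr 1; ring
  have hd : ∀ t ∈ Ioi (0 : ℝ), HasDerivAt (fun t : ℝ => t * (1 + t ^ r) ^ (-((b + 1) / r)))
      ((1 + t ^ r) ^ (-((b + 1 + r) / r))
        - b * (t ^ r * (1 + t ^ r) ^ (-((b + 1 + r) / r)))) t := fun t ht =>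
    (hasDerivAt_mul_one_add_rpow_rpow ht hr (b + 1)).congr_deriv (by ring)
  have key := integral_Ioi_of_hasDerivAt_of_tendsto hcont hd (i1.sub i2) hlim
  rw [integral_sub i1 i2, integral_const_mul] at key
  simp only [zero_mul, sub_zero] at key
  linarith

theorem integral_one_add_rpow_rpow_eq_betaFn (hr : 0 < r) (q : ℝ) :
    ∫ t in Ioi (0 : ℝ), (1 + t ^ r) ^ (-(q / r)) = 1 / r * betaFn (1 / r) ((q - 1) / r) := by
  set φ : ℝ → ℝ := fun t => 1 - (1 + t ^ r)⁻¹ with hφ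
  have hd : ∀ t ∈ Ioi (0 : ℝ), HasDerivWithinAt φ (r * t ^ (r - 1) / (1 + t ^ r) ^ 2) (Ioi 0) t :=
    fun t ht => by
    have ht' : 0 < t := ht
    have hp : 0 < 1 + t ^ r := by positivity
    have h1 : HasDerivAt (fun t : ℝ => 1 + t ^ r) (r * t ^ (r - 1)) t :=
      (Real.hasDerivAt_rpow_const (Or.inl ht'.ne')).const_add 1
    exact ((h1.inv hp.ne').const_sub 1).hasDerivWithinAt.congr_deriv (by ring)
  have hmono : StrictMonoOn φ (Ioi 0) := fun x hx y hy hxy => by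
    have hx' : 0 < x := hx
    have := Real.rpow_lt_rpow hx'.le hxy hr
    have h2 : (1 + y ^ r)⁻¹ < (1 + x ^ r)⁻¹ := inv_strictAnti₀ (by positivity) (by linarith)
    simp only [hφ]; linarith
  have himg : φ '' Ioi 0 = Ioo 0 1 := by
    ext y
    constructor
    · rintro ⟨t, ht, rfl⟩
      have ht' : 0 < t ^ r := Real.rpow_pos_of_pos ht r
      have h2 : (1 + t ^ r)⁻¹ < 1 := inv_lt_one_of_one_lt₀ (by linarith)
      have h3 : 0 < (1 + t ^ r)⁻¹ := by positivity
      exact ⟨by simp only [hφ]; linarith, by simp only [hφ]; linarith⟩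
    · rintro ⟨h0, h1⟩
      have h2 : 0 < 1 - y := by linarith
      refine ⟨(y / (1 - y)) ^ r⁻¹, Real.rpow_pos_of_pos (div_pos h0 h2) _, ?_⟩
      simp only [hφ]
      rw [Real.rpow_inv_rpow (div_pos h0 h2).le hr.ne']
      field_simp
      ring
  rw [betaFn, ← himg, integral_image_eq_integral_abs_deriv_smul measurableSet_Ioi hd hmono.injOn,
    ← integral_const_mul]
  refine setIntegral_congr_fun measurableSet_Ioi fun t ht => ?_
  have ht' : 0 < t := ht
  have hp : 0 < 1 + t ^ r := by positivity
  have e1 : φ t = t ^ r * (1 + t ^ r)⁻¹ := by simp only [hφ]; field_simp; ring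
  have e2 : 1 - φ t = (1 + t ^ r)⁻¹ := by simp only [hφ]; ring
  have e3 : |r * t ^ (r - 1) / (1 + t ^ r) ^ 2| = r * t ^ (r - 1) * (1 + t ^ r) ^ (-2 : ℝ) := by
    rw [abs_of_nonneg (by positivity), Real.rpow_neg hp.le, div_eq_mul_inv]
    norm_num
  simp only [smul_eq_mul]
  rw [e2, e1, e3, Real.mul_rpow (by positivity) (by positivity), ← Real.rpow_neg_one,
    ← Real.rpow_mul hp.le, ← Real.rpow_mul hp.le, ← Real.rpow_mul ht'.le]
  have e4 : t ^ (r - 1) * t ^ (r * (1 / r - 1)) = 1 := by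
    rw [← Real.rpow_add ht']
    have : r - 1 + r * (1 / r - 1) = 0 := by field_simp; ring
    rw [this, Real.rpow_zero]
  have e5 : (1 + t ^ r) ^ (-(q / r)) = (1 + t ^ r) ^ (-2 : ℝ) * (1 + t ^ r) ^ (-1 * (1 / r - 1))
      * (1 + t ^ r) ^ (-1 * ((q - 1) / r - 1)) := by
    rw [← Real.rpow_add hp, ← Real.rpow_add hp]; congr 1; field_simp; ring
  rw [e5]
  generalize (1 + t ^ r) ^ (-2 : ℝ) = A
  generalize (1 + t ^ r) ^ (-1 * (1 / r - 1)) = B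
  generalize (1 + t ^ r) ^ (-1 * ((q - 1) / r - 1)) = C
  calc A * B * C = (1 / r * r) * (t ^ (r - 1) * t ^ (r * (1 / r - 1))) * (A * B * C) := by
        rw [e4]; field_simp
    _ = _ := by ring

end Extremal

theorem transport_density_bound {p r q b s T F c Z : ℝ} (hp : 1 < p) (hr : 0 < r)
    (hq : q = p * (1 + r)) (hb : b = (p - 1) * (1 + r)) (hs : 0 < s) (hT : 0 < T) (hF : 0 < F)
    (hc : 0 < c) (hZ : 0 < Z) :
    b * c ^ (r / q) * (s ^ (r - q) * F ^ q * (T ^ (-r) * Z)) ≤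
      F ^ (b + 1) * (T ^ (-(r * (p - 1) / p)) * s ^ (-((p - 1) / p * (b + 1))) *
        (r * (p - 1) / p * (c * (s ^ (r - q) * F ^ q) / (T ^ r * Z ^ (-(q / r))) / T)
          + (p - 1) / p * (b + 1) / s)) := by
  have hp0 : 0 < p := by linarith
  have hp1 : 0 < p - 1 := by linarith
  have hq0 : 0 < q := by rw [hq]; positivity
  have hb0 : 0 < b := by rw [hb]; positivity
  have hrq : r < q := by rw [hq]; nlinarith
  set y := c * (s ^ (r - q) * F ^ q) / (T ^ r * Z ^ (-(q / r))) / T with hy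
  have hy0 : 0 < y := by positivity
  have amgm : b * (y ^ (r / q) * (1 / s) ^ (1 - r / q)) ≤
      r * (p - 1) / p * y + (p - 1) / p * (b + 1) / s := by
    have := Real.geom_mean_le_arith_mean2_weighted (w₁ := r / q) (w₂ := 1 - r / q) (p₁ := y)
      (p₂ := 1 / s) (by positivity) (by rw [sub_nonneg, div_le_one hq0]; exact hrq.le)
      hy0.le (by positivity) (by ring)
    calc _ ≤ b * (r / q * y + (1 - r / q) * (1 / s)) := mul_le_mul_of_nonneg_left this hb0.le
      _ = _ := by
        rw [hb, hq]; field_simp; ring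
  refine le_trans (le_of_eq ?_) (mul_le_mul_of_nonneg_left (mul_le_mul_of_nonneg_left amgm
    (by positivity)) (by positivity))
  have key : c ^ (r / q) * (s ^ (r - q) * F ^ q * (T ^ (-r) * Z)) =
      F ^ (b + 1) * (T ^ (-(r * (p - 1) / p)) * s ^ (-((p - 1) / p * (b + 1))) *
        (y ^ (r / q) * (1 / s) ^ (1 - r / q))) := by
    clear amgm hy0
    rw [hy]
    clear_value y
    obtain ⟨s, rfl⟩ : ∃ x, Real.exp x = s := ⟨_, Real.exp_log hs⟩
    obtain ⟨T, rfl⟩ : ∃ x, Real.exp x = T := ⟨_, Real.exp_log hT⟩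
    obtain ⟨F, rfl⟩ : ∃ x, Real.exp x = F := ⟨_, Real.exp_log hF⟩
    obtain ⟨c, rfl⟩ : ∃ x, Real.exp x = c := ⟨_, Real.exp_log hc⟩
    obtain ⟨Z, rfl⟩ : ∃ x, Real.exp x = Z := ⟨_, Real.exp_log hZ⟩
    simp only [← Real.exp_mul, ← Real.exp_add, ← Real.exp_sub, one_div, ← Real.exp_neg]
    congr 1
    rw [hb, hq]
    field_simp
    ring
  rw [mul_assoc, key]; ring

theorem setLIntegral_eq_of_forall_diff_eq_zero {U V : Set ℝ} (hU : MeasurableSet U)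
    (hV : MeasurableSet V) (hUV : U ⊆ V) {f : ℝ → ℝ≥0∞} (h : ∀ s ∈ V \ U, f s = 0) :
    ∫⁻ s in U, f s = ∫⁻ s in V, f s := by
  rw [← lintegral_indicator hU, ← lintegral_indicator hV]
  refine lintegral_congr fun s => ?_
  by_cases hs : s ∈ U
  · rw [indicator_of_mem hs, indicator_of_mem (hUV hs)]
  · rw [indicator_of_notMem hs]
    by_cases hs' : s ∈ V
    · rw [indicator_of_mem hs', h s ⟨hs', hs⟩]
    · rw [indicator_of_notMem hs']

theorem lipschitzWith_measureReal_Iio {m : Measure ℝ} [IsFiniteMeasure m] {k : NNReal}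
    (hm : m ≤ (k : ℝ≥0∞) • volume.restrict (Ioi 0)) :
    LipschitzWith k fun x => m.real (Iio x) := by
  refine LipschitzWith.of_le_add_mul k fun x y => ?_
  have h1 : Iio x ⊆ Iio y ∪ Ico y x := fun z hz => by
    rcases lt_or_ge z y with h | h
    · exact Or.inl h
    · exact Or.inr ⟨h, hz⟩
  have h2 : m (Ico y x) ≤ ENNReal.ofReal (k * dist x y) := by
    refine (hm _).trans ?_
    rw [Measure.smul_apply, smul_eq_mul, ENNReal.ofReal_mul k.coe_nonneg, ENNReal.ofReal_coe_nnreal]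
    gcongr
    refine (Measure.restrict_apply_le _ _).trans ?_
    rw [Real.volume_Ico]
    exact ENNReal.ofReal_le_ofReal (le_abs_self _)
  calc m.real (Iio x) ≤ m.real (Iio y ∪ Ico y x) := measureReal_mono h1
    _ ≤ m.real (Iio y) + m.real (Ico y x) := measureReal_union_le _ _
    _ ≤ _ := by
      gcongr
      exact ENNReal.toReal_le_of_le_ofReal (by positivity) h2

theorem lintegral_measureReal_Iio_rpow_mul (m : Measure ℝ) [IsFiniteMeasure m]
    (hF : Continuous fun x => m.real (Iio x)) (h0 : m (Iio 0) = 0) {b : ℝ} (hb : 0 < b)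
    {φ : ℝ → ℝ≥0∞} (hφ : Measurable φ) :
    ∫⁻ s, ENNReal.ofReal (m.real (Iio s) ^ (b + 1)) * φ s = ENNReal.ofReal (b + 1) *
      ∫⁻ t, ENNReal.ofReal (m.real (Iio t) ^ b) * (∫⁻ s in Ioi t, φ s) ∂m := by
  have hFm : Measurable fun t => ENNReal.ofReal (m.real (Iio t) ^ b) :=
    (hF.measurable.pow_const b).ennreal_ofReal
  have hset : MeasurableSet {z : ℝ × ℝ | z.2 < z.1} := measurableSet_lt measurable_snd measurable_fst
  have hrepr : ∀ s, ENNReal.ofReal (m.real (Iio s) ^ (b + 1)) * φ s = ENNReal.ofReal (b + 1) *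
      ∫⁻ t, {z : ℝ × ℝ | z.2 < z.1}.indicator
        (fun z => ENNReal.ofReal (m.real (Iio z.2) ^ b) * φ z.1) (s, t) ∂m := fun s => by
    have h1 : ∀ t, {z : ℝ × ℝ | z.2 < z.1}.indicator
        (fun z => ENNReal.ofReal (m.real (Iio z.2) ^ b) * φ z.1) (s, t)
        = (Iio s).indicator (fun t => ENNReal.ofReal (m.real (Iio t) ^ b)) t * φ s := fun t => by
      by_cases h : t < s <;> simp [indicator, h]
    simp only [h1]
    rw [lintegral_mul_const _ (hFm.indicator measurableSet_Iio), lintegral_indicator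
      measurableSet_Iio, lintegral_Iio_measureReal_rpow m hF h0 hb, ← mul_assoc,
      ← ENNReal.ofReal_mul (by linarith), mul_div_cancel₀ _ (by linarith)]
  have hmeas : Measurable ({z : ℝ × ℝ | z.2 < z.1}.indicator
        (fun z => ENNReal.ofReal (m.real (Iio z.2) ^ b) * φ z.1)) :=
    ((hFm.comp measurable_snd).mul (hφ.comp measurable_fst)).indicator hset
  simp only [hrepr]
  rw [lintegral_const_mul _ hmeas.lintegral_prod_right',
    lintegral_lintegral_swap (f := fun s t => {z : ℝ × ℝ | z.2 < z.1}.indicator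
        (fun z => ENNReal.ofReal (m.real (Iio z.2) ^ b) * φ z.1) (s, t)) hmeas.aemeasurable]
  congr 1
  refine lintegral_congr fun t => ?_
  have h1 : ∀ s, {z : ℝ × ℝ | z.2 < z.1}.indicator
        (fun z => ENNReal.ofReal (m.real (Iio z.2) ^ b) * φ z.1) (s, t)
        = ENNReal.ofReal (m.real (Iio t) ^ b) * (Ioi t).indicator φ s := fun s => by
      by_cases h : t < s <;> simp [indicator, h]
  simp only [h1]
  rw [lintegral_const_mul _ (hφ.indicator measurableSet_Ioi), lintegral_indicator
      measurableSet_Ioi]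

theorem measurable_indicator_ofReal_of_continuousOn {g : ℝ → ℝ} {U : Set ℝ} (hU : MeasurableSet U)
    (hg : ContinuousOn g U) : Measurable (U.indicator fun s => ENNReal.ofReal (g s)) := by
  classical
  have h : ContinuousOn (fun s => ENNReal.ofReal (g s)) U :=
    ENNReal.continuous_ofReal.comp_continuousOn hg
  have := h.measurable_piecewise (continuousOn_const (c := (0 : ℝ≥0∞))) hU
  exact (piecewise_eq_indicator (s := U) (f := fun s => ENNReal.ofReal (g s))) ▸ this

/-- The upper bound in the one-dimensional inequality of Bliss, for a measure whose action on
functions is bounded by an `L^p'` norm. -/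
theorem bliss_inequality {p r q b : ℝ} (hp : 1 < p) (hr : 0 < r) (hq : q = p * (1 + r))
    (hb : b = (p - 1) * (1 + r)) (m : Measure ℝ) [IsFiniteMeasure m] {k : NNReal}
    (hm : m ≤ (k : ℝ≥0∞) • volume.restrict (Ioi 0)) (A : ℝ≥0∞)
    (hA : ∀ h : ℝ → ℝ≥0∞, Measurable h →
      ∫⁻ t, h t ∂m ≤ A * (∫⁻ s in Ioi 0, h s ^ (p / (p - 1))) ^ (1 / (p / (p - 1)))) :
    (∫⁻ s in Ioi 0, ENNReal.ofReal (s ^ (r - q) * m.real (Iio s) ^ q)) ^ (1 / q) ≤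
      ENNReal.ofReal (b ^ (-(1 / q)) *
        (∫ t in Ioi (0 : ℝ), (1 + t ^ r) ^ (-(q / r))) ^ (-(r / q))) * A := by
  have hp0 : 0 < p := by linarith
  have hp1 : 0 < p - 1 := by linarith
  have hq0 : 0 < q := by rw [hq]; positivity
  have hb0 : 0 < b := by rw [hb]; positivity
  have hqb : q = b + 1 + r := by rw [hq, hb]; ring
  have hlip := lipschitzWith_measureReal_Iio hm
  have hFc := hlip.continuous
  have h00 : m (Iio 0) = 0 := by
    refine le_antisymm ((hm _).trans ?_) zero_le
    rw [Measure.smul_apply, Measure.restrict_apply measurableSet_Iio]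
    have : Iio (0 : ℝ) ∩ Ioi 0 = ∅ := by ext x; simp; intro h; linarith
    simp [this]
  set F : ℝ → ℝ := fun x => m.real (Iio x) with hFdef
  have hF0 : ∀ x, 0 ≤ F x := fun x => measureReal_nonneg
  have hFmono : Monotone F := fun x y hxy => measureReal_mono (Iio_subset_Iio hxy)
  have hFz : F 0 = 0 := by simp [hFdef, measureReal_def, h00]
  have hFneg : ∀ x ≤ 0, F x = 0 := fun x hx => le_antisymm (hFz ▸ hFmono hx) (hF0 x)
  have hFk : ∀ s, 0 < s → F s ≤ k * s := fun s hs => by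
    have := hlip.dist_le_mul s 0
    rw [Real.dist_eq, Real.dist_eq, hFz, sub_zero, sub_zero, abs_of_pos hs] at this
    exact (le_abs_self _).trans this
  set w : ℝ → ℝ := fun s => s ^ (r - q) * F s ^ q with hwdef
  set v : ℝ → ℝ := fun t => t ^ r * (1 + t ^ r) ^ (-(q / r)) with hvdef
  have hw0 : ∀ s, 0 < s → 0 ≤ w s := fun s hs => by have := hF0 s; positivity
  have hwF : ∀ s, 0 < s → (0 < w s ↔ 0 < F s) := fun s hs => by
    constructor
    · intro h
      refine (hF0 s).lt_of_ne fun h' => ?_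
      simp only [hwdef, ← h', Real.zero_rpow hq0.ne', mul_zero, lt_irrefl] at h
    · intro h; positivity
  have hwc : ContinuousOn w (Ioi 0) :=
    (continuousOn_id.rpow_const fun t ht => Or.inl (ne_of_gt ht)).mul
      (hFc.rpow_const fun _ => Or.inr hq0.le).continuousOn
  have hwi : IntegrableOn w (Ioi 0) := by
    refine integrableOn_Ioi_of_le_rpow (α := r) (δ := r - q) (C := k ^ q)
      (D := m.real univ ^ q) hwc hw0 (by linarith) (by linarith) (fun s hs _ => ?_) fun s hs => ?_
    · calc w s ≤ s ^ (r - q) * (k * s) ^ q := mul_le_mul_of_nonneg_left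
            (Real.rpow_le_rpow (hF0 s) (hFk s hs) hq0.le) (by positivity)
        _ = k ^ q * (s ^ (r - q) * s ^ q) := by rw [Real.mul_rpow k.coe_nonneg hs.le]; ring
        _ = _ := by rw [← Real.rpow_add hs]; congr 2; ring
    · rw [mul_comm]
      exact mul_le_mul_of_nonneg_left (Real.rpow_le_rpow (hF0 s)
        (measureReal_mono (subset_univ _)) hq0.le) (by positivity)
  have hup : ∀ s t, 0 < s → s ≤ t → 0 < w s → 0 < w t := fun s t hs hst h =>
    (hwF t (hs.trans_le hst)).2 (((hwF s hs).1 h).trans_le (hFmono hst))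
  have hv0 : ∀ s, 0 < s → 0 < v s := fun s hs => by positivity
  have hvc : ContinuousOn v (Ioi 0) :=
    (continuousOn_id.rpow_const fun t ht => Or.inl (ne_of_gt ht)).mul
      (continuousOn_one_add_rpow_rpow r _)
  have hvi : IntegrableOn v (Ioi 0) :=
    integrableOn_rpow_mul_one_add_rpow_rpow hr (by linarith)
  have hKi : IntegrableOn (fun t : ℝ => (1 + t ^ r) ^ (-(q / r))) (Ioi 0) :=
    integrableOn_one_add_rpow_rpow hr (by linarith)
  have hKN : ∫ t in Ioi (0 : ℝ), (1 + t ^ r) ^ (-(q / r)) = b * ∫ t in Ioi (0 : ℝ), v t := by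
    have := integral_one_add_rpow_rpow hr hb0
    rw [← hqb] at this
    exact this
  have hwM : ∫⁻ s in Ioi 0, ENNReal.ofReal (w s) = ENNReal.ofReal (∫ s in Ioi (0 : ℝ), w s) :=
    (ofReal_integral_eq_lintegral_ofReal hwi
      ((ae_restrict_mem measurableSet_Ioi).mono fun s hs => hw0 s hs)).symm
  have hN : 0 < ∫ t in Ioi (0 : ℝ), v t := by
    rw [setIntegral_pos_iff_support_of_nonneg_ae
      ((ae_restrict_mem measurableSet_Ioi).mono fun s hs => (hv0 s hs).le) hvi]
    have : Function.support v ∩ Ioi 0 = Ioi 0 :=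
      inter_eq_right.2 fun s hs => (hv0 s hs).ne'
    rw [this, Real.volume_Ioi]; exact ENNReal.zero_lt_top
  change (∫⁻ s in Ioi 0, ENNReal.ofReal (w s)) ^ (1 / q) ≤ _
  rw [hwM]
  rcases (setIntegral_nonneg measurableSet_Ioi hw0).eq_or_lt with hM | hM
  · rw [← hM, ENNReal.ofReal_zero, ENNReal.zero_rpow_of_pos (by positivity)]
    exact zero_le
  obtain ⟨T, hT, hTmono, hTimg⟩ := exists_monotone_transport hw0 hwc hwi hup hM hv0 hvc hvi hN
  have hUo : IsOpen {s | 0 < s ∧ 0 < w s} := hwc.isOpen_inter_preimage isOpen_Ioi isOpen_Ioi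
  set U : Set ℝ := {s | 0 < s ∧ 0 < w s} with hUdef
  have hUm : MeasurableSet U := hUo.measurableSet
  have hKv : ∀ t, 0 < t → v t * t ^ (-r) = (1 + t ^ r) ^ (-(q / r)) := fun t ht => by
    simp only [hvdef]
    rw [mul_right_comm, ← Real.rpow_add ht, add_neg_cancel, Real.rpow_zero, one_mul]
  rw [hKN]
  set N := ∫ t in Ioi (0 : ℝ), v t
  set M := ∫ t in Ioi (0 : ℝ), w t
  have hc : 0 < N / M := div_pos hN hM
  have hUw : ∫⁻ s in U, ENNReal.ofReal (w s) = ENNReal.ofReal M := by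
    rw [← hwM]
    refine setLIntegral_eq_of_forall_diff_eq_zero hUm measurableSet_Ioi (fun s hs => hs.1) ?_
    intro s hs
    exact ENNReal.ofReal_eq_zero.2 (not_lt.1 fun h => hs.2 ⟨hs.1, h⟩)
  have hUX : ∫⁻ s in U, ENNReal.ofReal (w s * T s ^ (-r)) = ENNReal.ofReal (b * M) := by
    have h1 := lintegral_image_eq_lintegral_deriv_mul_of_monotoneOn hUm
      (fun s hs => (hT s hs).2.hasDerivWithinAt) hTmono
      (fun t => ENNReal.ofReal (v t * t ^ (-r)))
    rw [hTimg, setLIntegral_congr_fun measurableSet_Ioi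
      (fun t ht => congrArg ENNReal.ofReal (hKv t ht)),
      ← ofReal_integral_eq_lintegral_ofReal hKi
        ((ae_restrict_mem measurableSet_Ioi).mono fun s (hs : 0 < s) => by positivity), hKN] at h1
    have h2 : ∫⁻ s in U, ENNReal.ofReal (w s * T s ^ (-r)) = ENNReal.ofReal (M / N) *
        ENNReal.ofReal (b * N) := by
      rw [h1, ← lintegral_const_mul' _ _ ENNReal.ofReal_ne_top]
      refine setLIntegral_congr_fun hUm fun s hs => ?_
      have hTs := (hT s hs).1
      have := hv0 _ hTs
      have := hs.2
      have := hs.1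
      rw [← ENNReal.ofReal_mul (by positivity), ← ENNReal.ofReal_mul (by positivity)]
      congr 1
      field_simp
    rw [h2, ← ENNReal.ofReal_mul (by positivity)]
    congr 1
    field_simp
  set τ : ℝ → ℝ := fun s => T s ^ (-(r * (p - 1) / p)) * s ^ (-((p - 1) / p * (b + 1))) with hτ
  set φ : ℝ → ℝ := fun s => τ s * (r * (p - 1) / p * (N / M * w s / v (T s) / T s)
    + (p - 1) / p * (b + 1) / s) with hφ
  have hTc : ContinuousOn T U := fun s hs => (hT s hs).2.continuousAt.continuousWithinAt
  have hτ0 : ∀ s ∈ U, 0 < τ s := fun s hs => by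
    have := (hT s hs).1
    have := hs.1
    positivity
  have hφ0 : ∀ s ∈ U, 0 ≤ φ s := fun s hs => by
    have h1 := (hT s hs).1
    have := hs.1
    have := hs.2
    have := hv0 _ h1
    have := hτ0 s hs
    positivity
  have hτc : ContinuousOn τ U :=
    (hTc.rpow_const fun s hs => Or.inl (hT s hs).1.ne').mul
      (continuousOn_id.rpow_const fun s hs => Or.inl hs.1.ne')
  have hφc : ContinuousOn φ U := by
    have hvT : ContinuousOn (fun s => v (T s)) U := hvc.comp hTc fun s hs => (hT s hs).1
    refine hτc.mul ((continuousOn_const.mul ((ContinuousOn.div (continuousOn_const.mul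
      (hwc.mono fun s hs => hs.1)) hvT fun s hs => (hv0 _ (hT s hs).1).ne').div hTc
      fun s hs => (hT s hs).1.ne')).add (continuousOn_const.div continuousOn_id
      fun s hs => hs.1.ne'))
  have hτd : ∀ s ∈ U, HasDerivAt τ (-φ s) s := fun s hs => by
    have hTs := (hT s hs).1
    have hs0 := hs.1
    refine (((hT s hs).2.rpow_const (Or.inl hTs.ne')).mul
      (Real.hasDerivAt_rpow_const (Or.inl hs0.ne'))).congr_deriv ?_
    rw [Real.rpow_sub_one hTs.ne', Real.rpow_sub_one hs0.ne']
    simp only [hφ, hτ]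
    ring
  have hτanti : AntitoneOn τ U := fun x hx y hy hxy => by
    have hTx := (hT x hx).1
    have hx0 := hx.1
    have hb1 : 0 < b + 1 := by linarith
    refine mul_le_mul ?_ ?_ (by have := hy.1; positivity) (by positivity)
    · exact Real.rpow_le_rpow_of_nonpos hTx (hTmono hx hy hxy) (neg_nonpos.2 (by positivity))
    · exact Real.rpow_le_rpow_of_nonpos hx0 hxy (neg_nonpos.2 (by positivity))
  have htail : ∀ t ∈ U, ∫⁻ s in Ioi t, ENNReal.ofReal (φ s) ≤ ENNReal.ofReal (τ t) := by
    intro t ht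
    have hsub : Ioi t ⊆ U := fun s hs =>
      ⟨ht.1.trans hs, hup t s ht.1 (le_of_lt hs) ht.2⟩
    have h1 := lintegral_deriv_eq_volume_image_of_antitoneOn (measurableSet_Ioi (a := t))
      (fun s hs => (hτd s (hsub hs)).hasDerivWithinAt) (hτanti.mono hsub)
    simp only [neg_neg] at h1
    rw [h1]
    calc volume (τ '' Ioi t) ≤ volume (Icc 0 (τ t)) := by
          refine measure_mono ?_
          rintro _ ⟨s, hs, rfl⟩
          exact ⟨(hτ0 s (hsub hs)).le, hτanti ht (hsub hs) (le_of_lt hs)⟩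
      _ = _ := by rw [Real.volume_Icc, sub_zero]
  have hlower : ENNReal.ofReal (b * (N / M) ^ (r / q) * (M + b * M)) ≤
      ∫⁻ s, ENNReal.ofReal (F s ^ (b + 1)) * U.indicator (fun s => ENNReal.ofReal (φ s)) s := by
    have h1 : ∫⁻ s in U, ENNReal.ofReal (b * (N / M) ^ (r / q)) *
        (ENNReal.ofReal (w s) + ENNReal.ofReal (w s * T s ^ (-r)))
        = ENNReal.ofReal (b * (N / M) ^ (r / q) * (M + b * M)) := by
      rw [lintegral_const_mul' _ _ ENNReal.ofReal_ne_top, lintegral_add_left', hUw, hUX,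
        ← ENNReal.ofReal_add hM.le (by positivity), ← ENNReal.ofReal_mul (by positivity)]
      exact ((hwc.mono fun s hs => hs.1).aemeasurable hUm).ennreal_ofReal
    rw [← h1, ← lintegral_indicator hUm]
    refine lintegral_mono fun s => ?_
    by_cases hs : s ∈ U
    · have hTs := (hT s hs).1
      have hs0 := hs.1
      have hws := hs.2
      have hFs := (hwF s hs0).1 hws
      simp only [indicator_of_mem hs]
      rw [← ENNReal.ofReal_add (by positivity) (by positivity), ← ENNReal.ofReal_mul (by positivity),
        ← ENNReal.ofReal_mul (by positivity)]
      refine ENNReal.ofReal_le_ofReal ?_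
      have := transport_density_bound hp hr hq hb hs0 hTs hFs hc
        (by positivity : 0 < 1 + T s ^ r)
      refine le_trans (le_of_eq ?_) this
      have hz : T s ^ (-r) * (1 + T s ^ r) = 1 + T s ^ (-r) := by
        rw [mul_add, mul_one, ← Real.rpow_add hTs, neg_add_cancel, Real.rpow_zero, add_comm]
      rw [hz]
      simp only [hwdef]
      ring
    · simp only [indicator_of_notMem hs, zero_le]
  have hφm := measurable_indicator_ofReal_of_continuousOn hUm hφc
  set h : ℝ → ℝ≥0∞ := U.indicator fun s => ENNReal.ofReal (F s ^ b * τ s) with hh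
  have hhm : Measurable h := measurable_indicator_ofReal_of_continuousOn hUm
    ((hFc.rpow_const fun _ => Or.inr hb0.le).continuousOn.mul hτc)
  have hupper : ∫⁻ s, ENNReal.ofReal (F s ^ (b + 1)) * U.indicator (fun s => ENNReal.ofReal (φ s)) s
      ≤ ENNReal.ofReal (b + 1) * ∫⁻ t, h t ∂m := by
    rw [lintegral_measureReal_Iio_rpow_mul m hFc h00 hb0 hφm]
    gcongr with t
    by_cases ht : t ∈ U
    · simp only [hh, indicator_of_mem ht]
      rw [ENNReal.ofReal_mul (Real.rpow_nonneg (hF0 t) b)]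
      gcongr
      refine le_trans (lintegral_mono fun s => indicator_le_self _ _ _) (htail t ht)
    · have : F t = 0 := by
        rcases le_or_gt t 0 with h | h
        · exact hFneg t h
        · by_contra hne
          exact ht ⟨h, (hwF t h).2 ((hF0 t).lt_of_ne' hne)⟩
      change ENNReal.ofReal (F t ^ b) * _ ≤ _
      rw [this, Real.zero_rpow hb0.ne', ENNReal.ofReal_zero, zero_mul]
      exact zero_le
  have hnorm : ∫⁻ s in Ioi 0, h s ^ (p / (p - 1)) = ENNReal.ofReal (b * M) := by
    rw [← hUX]
    symm
    have h1 : ∀ s, s ∈ U → h s ^ (p / (p - 1)) = ENNReal.ofReal (w s * T s ^ (-r)) := by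
      intro s hs
      have hTs := (hT s hs).1
      have hs0 := hs.1
      have hFs := (hwF s hs0).1 hs.2
      have hτs := hτ0 s hs
      simp only [hh, indicator_of_mem hs]
      rw [ENNReal.ofReal_rpow_of_nonneg (by positivity) (by positivity)]
      congr 1
      simp only [hτ, hwdef]
      rw [Real.mul_rpow (by positivity) (by positivity), Real.mul_rpow (by positivity)
        (by positivity), ← Real.rpow_mul hFs.le, ← Real.rpow_mul hs0.le, ← Real.rpow_mul hTs.le]
      have e1 : b * (p / (p - 1)) = q := by rw [hb, hq]; field_simp
      have e2 : -(r * (p - 1) / p) * (p / (p - 1)) = -r := by field_simp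
      have e3 : -((p - 1) / p * (b + 1)) * (p / (p - 1)) = r - q := by
        rw [hqb]; field_simp; ring
      rw [e1, e2, e3]; ring
    rw [← setLIntegral_congr_fun hUm h1]
    refine (setLIntegral_eq_of_forall_diff_eq_zero hUm measurableSet_Ioi
      (fun s hs => hs.1) fun s hs => ?_)
    simp only [hh, indicator_of_notMem hs.2]
    exact ENNReal.zero_rpow_of_pos (by positivity)
  have hfinal := hlower.trans (hupper.trans (mul_le_mul_right (hA h hhm) _))
  rw [hnorm, ENNReal.ofReal_rpow_of_nonneg (by positivity) (by positivity)] at hfinal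
  have hb1 : 0 < b + 1 := by linarith
  have hκ : 0 ≤ M ^ (1 / q) / (b * (N / M) ^ (r / q) * (M + b * M)) := by positivity
  calc ENNReal.ofReal M ^ (1 / q)
      = ENNReal.ofReal (M ^ (1 / q) / (b * (N / M) ^ (r / q) * (M + b * M))) *
          ENNReal.ofReal (b * (N / M) ^ (r / q) * (M + b * M)) := by
        rw [ENNReal.ofReal_rpow_of_nonneg hM.le (by positivity), ← ENNReal.ofReal_mul hκ,
          div_mul_cancel₀]
        positivity
    _ ≤ ENNReal.ofReal (M ^ (1 / q) / (b * (N / M) ^ (r / q) * (M + b * M))) *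
          (ENNReal.ofReal (b + 1) * (A * ENNReal.ofReal ((b * M) ^ (1 / (p / (p - 1)))))) := by
        gcongr
    _ = ENNReal.ofReal (M ^ (1 / q) / (b * (N / M) ^ (r / q) * (M + b * M)) * (b + 1) *
          (b * M) ^ (1 / (p / (p - 1)))) * A := by
        rw [ENNReal.ofReal_mul (by positivity), ENNReal.ofReal_mul (by positivity)]
        ring
    _ = _ := by
        congr 2
        have e0 : M + b * M = (b + 1) * M := by ring
        have e4 : M ^ (1 / q) / (b * (N / M) ^ (r / q) * ((b + 1) * M)) * (b + 1) *
          (b * M) ^ (1 / (p / (p - 1))) = M ^ (1 / q) / (b * (N / M) ^ (r / q) * M) *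
          (b * M) ^ (1 / (p / (p - 1))) := by field_simp
        rw [e0, e4]
        have e5 : 1 / q = 1 / p - r / q := by rw [hq]; field_simp; ring
        have e6 : 1 / (p / (p - 1)) = 1 - 1 / p := by field_simp
        rw [e5, e6]
        generalize r / q = x
        generalize 1 / p = y
        obtain ⟨M, hM'⟩ : ∃ x, Real.exp x = M := ⟨_, Real.exp_log hM⟩
        obtain ⟨N, hN'⟩ : ∃ x, Real.exp x = N := ⟨_, Real.exp_log hN⟩
        obtain ⟨b, hb'⟩ : ∃ x, Real.exp x = b := ⟨_, Real.exp_log hb0⟩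
        rw [← hM', ← hN', ← hb']
        simp only [← Real.exp_mul, ← Real.exp_add, ← Real.exp_sub]
        congr 1
        ring

section Euclidean

variable {n : ℕ}

/-- The volume of the centered ball whose boundary passes through `x`. -/
noncomputable def ballVolume (x : EuclideanSpace ℝ (Fin n)) : ℝ :=
  volume.real (Metric.ball (0 : EuclideanSpace ℝ (Fin n)) ‖x‖)

theorem volume_ball_zero_eq (hn : 1 ≤ n) {R : ℝ} (hR : 0 ≤ R) :
    volume (Metric.ball (0 : EuclideanSpace ℝ (Fin n)) R) =
      ENNReal.ofReal (volume.real (Metric.ball (0 : EuclideanSpace ℝ (Fin n)) 1) * R ^ n) := by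
  have : Nonempty (Fin n) := ⟨⟨0, hn⟩⟩
  rw [Measure.addHaar_ball _ _ hR, finrank_euclideanSpace_fin, mul_comm (volume.real _),
    ENNReal.ofReal_mul (by positivity), ofReal_measureReal (Metric.isBounded_ball.measure_lt_top.ne)]

theorem volume_real_unit_ball_pos :
    0 < volume.real (Metric.ball (0 : EuclideanSpace ℝ (Fin n)) 1) :=
  ENNReal.toReal_pos (Metric.measure_ball_pos _ _ one_pos).ne' Metric.isBounded_ball.measure_lt_top.ne

theorem ballVolume_eq (hn : 1 ≤ n) (x : EuclideanSpace ℝ (Fin n)) :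
    ballVolume x = volume.real (Metric.ball (0 : EuclideanSpace ℝ (Fin n)) 1) * ‖x‖ ^ n := by
  rw [ballVolume, measureReal_def, volume_ball_zero_eq hn (norm_nonneg x),
    ENNReal.toReal_ofReal (by positivity)]

theorem measurable_ballVolume (hn : 1 ≤ n) :
    Measurable (ballVolume : EuclideanSpace ℝ (Fin n) → ℝ) := by
  have : (ballVolume : EuclideanSpace ℝ (Fin n) → ℝ) = _ := funext (ballVolume_eq hn)
  rw [this]
  fun_prop

theorem ballVolume_preimage_Iio (hn : 1 ≤ n) (x : EuclideanSpace ℝ (Fin n)) :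
    ballVolume ⁻¹' Iio (ballVolume x) = Metric.ball (0 : EuclideanSpace ℝ (Fin n)) ‖x‖ := by
  ext y
  have hc := volume_real_unit_ball_pos (n := n)
  simp only [mem_preimage, mem_Iio, ballVolume_eq hn, mem_ball_zero_iff]
  rw [mul_lt_mul_iff_right₀ hc, pow_lt_pow_iff_left₀ (norm_nonneg _) (norm_nonneg _) (by omega)]

theorem volume_ballVolume_preimage_Iio (hn : 1 ≤ n) (t : ℝ) :
    volume ((ballVolume : EuclideanSpace ℝ (Fin n) → ℝ) ⁻¹' Iio t) = ENNReal.ofReal t := by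
  have hc := volume_real_unit_ball_pos (n := n)
  set c := volume.real (Metric.ball (0 : EuclideanSpace ℝ (Fin n)) 1)
  rcases le_or_gt t 0 with ht | ht
  · have : (ballVolume : EuclideanSpace ℝ (Fin n) → ℝ) ⁻¹' Iio t = ∅ :=
      eq_empty_of_forall_notMem fun x hx => (measureReal_nonneg.trans_lt hx).not_ge ht
    rw [this, measure_empty, ENNReal.ofReal_of_nonpos ht]
  · set R := (t / c) ^ (n : ℝ)⁻¹ with hRdef
    have hR : 0 ≤ R := by positivity
    have hRn : c * R ^ n = t := by
      rw [hRdef, Real.rpow_inv_natCast_pow (by positivity) (by omega), mul_div_cancel₀ _ hc.ne']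
    have : (ballVolume : EuclideanSpace ℝ (Fin n) → ℝ) ⁻¹' Iio t = Metric.ball 0 R := by
      ext y
      simp only [mem_preimage, mem_Iio, ballVolume_eq hn, mem_ball_zero_iff]
      rw [← hRn, mul_lt_mul_iff_right₀ hc, pow_lt_pow_iff_left₀ (norm_nonneg _) hR (by omega)]
    rw [this, volume_ball_zero_eq hn hR, hRn]

theorem map_ballVolume (hn : 1 ≤ n) :
    (volume : Measure (EuclideanSpace ℝ (Fin n))).map ballVolume = volume.restrict (Ioi 0) := by
  have hm := measurable_ballVolume hn
  have hval : ∀ a b : ℝ, a < b → (volume : Measure (EuclideanSpace ℝ (Fin n))).map ballVolume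
      (Ico a b) = ENNReal.ofReal b - ENNReal.ofReal a := fun a b hab => by
    have h1 : Ico a b = Iio b \ Iio a := by
      ext x; simp only [mem_Ico, Set.mem_sdiff, mem_Iio, not_lt]; tauto
    rw [Measure.map_apply hm measurableSet_Ico, h1, preimage_sdiff,
      measure_sdiff (preimage_mono (Iio_subset_Iio hab.le)) (hm measurableSet_Iio).nullMeasurableSet,
      volume_ballVolume_preimage_Iio hn, volume_ballVolume_preimage_Iio hn]
    rw [volume_ballVolume_preimage_Iio hn]; exact ENNReal.ofReal_ne_top
  refine Measure.ext_of_Ico' _ _ (fun a b hab => ?_) fun a b hab => ?_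
  · rw [hval a b hab]; exact ne_top_of_le_ne_top ENNReal.ofReal_ne_top tsub_le_self
  · rw [hval a b hab, Measure.restrict_congr_set Ioi_ae_eq_Ici,
      Measure.restrict_apply measurableSet_Ico]
    have h1 : Ico a b ∩ Ici 0 = Ico (max a 0) b := by
      ext x; simp only [mem_inter_iff, mem_Ico, mem_Ici, max_le_iff]; tauto
    rw [h1, Real.volume_Ico]
    rcases le_or_gt a 0 with ha | ha
    · rw [max_eq_right ha, ENNReal.ofReal_of_nonpos ha, tsub_zero, sub_zero]
    · rw [max_eq_left ha.le, ENNReal.ofReal_sub _ ha.le]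

theorem fracHardy_eq (hn : 1 ≤ n) (β : ℝ) (f : EuclideanSpace ℝ (Fin n) → ℝ≥0∞)
    (x : EuclideanSpace ℝ (Fin n)) :
    fracHardy n β f x = ENNReal.ofReal (ballVolume x) ^ (β / (n : ℝ) - 1) *
      (volume.withDensity f).map ballVolume (Iio (ballVolume x)) := by
  rw [Measure.map_apply (measurable_ballVolume hn) measurableSet_Iio,
    ballVolume_preimage_Iio hn, withDensity_apply _ Metric.isOpen_ball.measurableSet, fracHardy,
    ballVolume, ofReal_measureReal Metric.isBounded_ball.measure_lt_top.ne]

theorem measurable_rpow_mul_Iio (m : Measure ℝ) (e : ℝ) :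
    Measurable fun s => ENNReal.ofReal s ^ e * m (Iio s) :=
  (ENNReal.measurable_ofReal.pow_const e).mul
    (Monotone.measurable fun _ _ h => measure_mono (Iio_subset_Iio h))

theorem measurable_fracHardy (hn : 1 ≤ n) (β : ℝ) (f : EuclideanSpace ℝ (Fin n) → ℝ≥0∞) :
    Measurable (fracHardy n β f) := by
  rw [show fracHardy n β f = _ from funext (fracHardy_eq hn β f)]
  exact (measurable_rpow_mul_Iio _ _).comp (measurable_ballVolume hn)

theorem lintegral_comp_ballVolume (hn : 1 ≤ n) {g : ℝ → ℝ≥0∞} (hg : Measurable g) :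
    ∫⁻ x : EuclideanSpace ℝ (Fin n), g (ballVolume x) = ∫⁻ s in Ioi 0, g s := by
  rw [← map_ballVolume hn, lintegral_map hg (measurable_ballVolume hn)]

theorem lintegral_fracHardy_rpow (hn : 1 ≤ n) (β : ℝ) {q : ℝ} (hq : 0 < q)
    (f : EuclideanSpace ℝ (Fin n) → ℝ≥0∞) :
    ∫⁻ x, fracHardy n β f x ^ q = ∫⁻ s in Ioi 0, ENNReal.ofReal (s ^ (q * β / n - q)) *
      (volume.withDensity f).map ballVolume (Iio s) ^ q := by
  simp only [fracHardy_eq hn]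
  rw [lintegral_comp_ballVolume hn
    (g := fun s => (ENNReal.ofReal s ^ (β / (n : ℝ) - 1) *
      (volume.withDensity f).map ballVolume (Iio s)) ^ q)
    ((measurable_rpow_mul_Iio _ _).pow_const q)]
  refine setLIntegral_congr_fun measurableSet_Ioi fun s hs => ?_
  rw [ENNReal.mul_rpow_of_nonneg _ _ hq.le, ← ENNReal.rpow_mul, ENNReal.ofReal_rpow_of_pos hs]
  congr 3
  ring

theorem fracHardy_mono (β : ℝ) {f g : EuclideanSpace ℝ (Fin n) → ℝ≥0∞} (h : f ≤ g) :
    fracHardy n β f ≤ fracHardy n β g := fun _ =>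
  mul_le_mul_right (lintegral_mono h) _

theorem lintegral_fracHardy_rpow_le_of_bounded (hn : 1 ≤ n) {β p q r b : ℝ} (hp : 1 < p)
    (hr : 0 < r) (hrβ : r = q * β / n) (hq : q = p * (1 + r)) (hb : b = (p - 1) * (1 + r))
    {f : EuclideanSpace ℝ (Fin n) → ℝ≥0∞} (hf : Measurable f) (hfi : ∫⁻ x, f x ≠ ∞) {k : NNReal}
    (hk : ∀ x, f x ≤ k) :
    (∫⁻ x, fracHardy n β f x ^ q) ^ (1 / q) ≤ ENNReal.ofReal (b ^ (-(1 / q)) *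
        (∫ t in Ioi (0 : ℝ), (1 + t ^ r) ^ (-(q / r))) ^ (-(r / q))) *
          (∫⁻ x, f x ^ p) ^ (1 / p) := by
  have hq0 : 0 < q := by rw [hq]; positivity
  have hσ := measurable_ballVolume hn
  have : IsFiniteMeasure (volume.withDensity f) := isFiniteMeasure_withDensity hfi
  set m := (volume.withDensity f).map ballVolume with hm
  have hmk : m ≤ (k : ℝ≥0∞) • volume.restrict (Ioi 0) := by
    rw [← map_ballVolume hn, ← Measure.map_smul, ← withDensity_const]
    exact Measure.map_mono (withDensity_mono (ae_of_all _ hk)) hσ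
  have hA : ∀ h : ℝ → ℝ≥0∞, Measurable h → ∫⁻ t, h t ∂m ≤ (∫⁻ x, f x ^ p) ^ (1 / p) *
      (∫⁻ s in Ioi 0, h s ^ (p / (p - 1))) ^ (1 / (p / (p - 1))) := fun h hh => by
    have hfh := lintegral_withDensity_eq_lintegral_mul volume hf (hh.comp hσ)
    simp only [Function.comp_apply] at hfh
    rw [hm, lintegral_map hh hσ, hfh, ← lintegral_comp_ballVolume hn (hh.pow_const _)]
    exact ENNReal.lintegral_mul_le_Lp_mul_Lq volume (Real.HolderConjugate.conjExponent hp)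
      hf.aemeasurable (hh.comp hσ).aemeasurable
  refine le_trans (le_of_eq ?_) (bliss_inequality hp hr hq hb m hmk _ hA)
  rw [lintegral_fracHardy_rpow hn β hq0, ← hrβ]
  congr 1
  refine setLIntegral_congr_fun measurableSet_Ioi fun s hs => ?_
  have hs' : 0 < s := hs
  rw [ENNReal.ofReal_mul (by positivity), ← ENNReal.ofReal_rpow_of_nonneg measureReal_nonneg hq0.le,
    ofReal_measureReal]

theorem fracHardy_iSup (β : ℝ) {f : ℕ → EuclideanSpace ℝ (Fin n) → ℝ≥0∞}
    (hf : ∀ j, Measurable (f j)) (hmono : Monotone f) (x : EuclideanSpace ℝ (Fin n)) :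
    fracHardy n β (fun y => ⨆ j, f j y) x = ⨆ j, fracHardy n β (f j) x := by
  simp only [fracHardy]
  rw [lintegral_iSup hf hmono, ENNReal.mul_iSup]

theorem exists_truncation {f : EuclideanSpace ℝ (Fin n) → ℝ≥0∞} (hf : Measurable f) :
    ∃ F : ℕ → EuclideanSpace ℝ (Fin n) → ℝ≥0∞, (∀ j, Measurable (F j)) ∧ Monotone F ∧
      (∀ j, ∫⁻ x, F j x ≠ ∞) ∧ (∀ j x, F j x ≤ (j : NNReal)) ∧ ∀ x, f x = ⨆ j, F j x := by
  refine ⟨fun j => (Metric.ball 0 (j : ℝ)).indicator fun x => min (f x) j, fun j =>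
    (hf.min measurable_const).indicator Metric.isOpen_ball.measurableSet, fun i j hij x => ?_,
    fun j => ?_, fun j x => ?_, fun x => ?_⟩
  · have hij' : (i : ℝ) ≤ j := by exact_mod_cast hij
    have hij'' : (i : ℝ≥0∞) ≤ j := by exact_mod_cast hij
    refine (indicator_le_indicator_of_subset (Metric.ball_subset_ball hij')
      (fun _ => zero_le) x).trans (indicator_le_indicator (min_le_min_left _ hij''))
  · rw [lintegral_indicator Metric.isOpen_ball.measurableSet]
    refine ne_top_of_le_ne_top ?_ (lintegral_mono (g := fun _ => (j : ℝ≥0∞))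
      fun x => min_le_right _ _)
    rw [setLIntegral_const]
    exact ENNReal.mul_ne_top (ENNReal.natCast_ne_top j) Metric.isBounded_ball.measure_lt_top.ne
  · refine (indicator_le_self _ _ x).trans ((min_le_right _ _).trans ?_)
    simp
  · refine le_antisymm (le_of_forall_lt fun c hc => ?_) (iSup_le fun j =>
      (indicator_le_self _ _ x).trans (min_le_left _ _))
    obtain ⟨j, hj⟩ := ENNReal.exists_nat_gt (ne_top_of_lt hc)
    obtain ⟨i, hi⟩ := exists_nat_gt ‖x‖
    have hx : x ∈ Metric.ball (0 : EuclideanSpace ℝ (Fin n)) ((max i j : ℕ) : ℝ) := by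
      rw [mem_ball_zero_iff]
      exact hi.trans_le (by exact_mod_cast le_max_left i j)
    refine lt_of_lt_of_le ?_ (le_iSup _ (max i j))
    beta_reduce
    rw [indicator_of_mem hx]
    exact lt_min hc (hj.trans_le (by exact_mod_cast le_max_right i j))

theorem lintegral_fracHardy_rpow_le (hn : 1 ≤ n) {β p q r b : ℝ} (hp : 1 < p)
    (hr : 0 < r) (hrβ : r = q * β / n) (hq : q = p * (1 + r)) (hb : b = (p - 1) * (1 + r))
    {f : EuclideanSpace ℝ (Fin n) → ℝ≥0∞} (hf : Measurable f) :
    (∫⁻ x, fracHardy n β f x ^ q) ^ (1 / q) ≤ ENNReal.ofReal (b ^ (-(1 / q)) *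
        (∫ t in Ioi (0 : ℝ), (1 + t ^ r) ^ (-(q / r))) ^ (-(r / q))) *
          (∫⁻ x, f x ^ p) ^ (1 / p) := by
  have hp0 : 0 < p := by linarith
  have hq0 : 0 < q := by rw [hq]; positivity
  obtain ⟨F, hFm, hFmono, hFi, hFk, hfF⟩ := exists_truncation hf
  have h1 : ∀ x, fracHardy n β f x ^ q = ⨆ j, fracHardy n β (F j) x ^ q := fun x => by
    rw [show f = _ from funext hfF, fracHardy_iSup β hFm hFmono]
    exact (ENNReal.orderIsoRpow q hq0).map_iSup _
  simp only [h1]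
  rw [lintegral_iSup (fun j => (measurable_fracHardy hn β _).pow_const q) fun i j hij x =>
    ENNReal.rpow_le_rpow (fracHardy_mono β (hFmono hij) x) hq0.le]
  refine ((ENNReal.orderIsoRpow (1 / q) (by positivity)).map_iSup _).trans_le (iSup_le fun j => ?_)
  refine (lintegral_fracHardy_rpow_le_of_bounded hn hp hr hrβ hq hb (hFm j) (hFi j) (hFk j)).trans ?_
  gcongr with x
  rw [hfF x]
  exact le_iSup (fun j => F j x) j

theorem lintegral_Ioo_extremal {r : ℝ} (hr : 0 < r) {s : ℝ} (hs : 0 < s) :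
    ∫⁻ t in Ioo 0 s, ENNReal.ofReal ((1 + t ^ r) ^ (-((1 + r) / r))) =
      ENNReal.ofReal (s * (1 + s ^ r) ^ (-(1 / r))) := by
  have hi : IntegrableOn (fun t : ℝ => (1 + t ^ r) ^ (-((1 + r) / r))) (Ioc 0 s) :=
    (integrableOn_one_add_rpow_rpow hr (e := 1 + r) (by linarith)).mono_set fun _ h => h.1
  rw [setLIntegral_congr Ioo_ae_eq_Ioc, ← ofReal_integral_eq_lintegral_ofReal hi
    ((ae_restrict_mem measurableSet_Ioc).mono fun t ht => by have := ht.1; positivity),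
    ← intervalIntegral.integral_of_le hs.le,
    intervalIntegral.integral_eq_sub_of_hasDerivAt_of_le hs.le (f := fun t : ℝ =>
      t * (1 + t ^ r) ^ (-(1 / r))) ?_ (fun t ht =>
      (hasDerivAt_mul_one_add_rpow_rpow ht.1 hr 1).congr_deriv (by ring))
      ((intervalIntegrable_iff_integrableOn_Ioc_of_le hs.le).2 hi)]
  · simp
  · refine continuousOn_id.mul (ContinuousOn.rpow_const (continuousOn_const.add
      (continuousOn_id.rpow_const fun _ _ => Or.inr hr.le)) fun t ht => Or.inl ?_)
    have := Real.rpow_nonneg ht.1 r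
    positivity

theorem le_of_fracHardy_bound (hn : 1 ≤ n) {β p q r b : ℝ} (hp : 1 < p)
    (hr : 0 < r) (hrβ : r = q * β / n) (hq : q = p * (1 + r)) (hb : b = (p - 1) * (1 + r))
    {C : ℝ≥0∞} (hC : ∀ f : EuclideanSpace ℝ (Fin n) → ℝ≥0∞, Measurable f →
        (∫⁻ x, fracHardy n β f x ^ q) ^ (1 / q) ≤ C * (∫⁻ x, f x ^ p) ^ (1 / p)) :
    ENNReal.ofReal (b ^ (-(1 / q)) *
        (∫ t in Ioi (0 : ℝ), (1 + t ^ r) ^ (-(q / r))) ^ (-(r / q))) ≤ C := by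
  have hp0 : 0 < p := by linarith
  have hp1 : 0 < p - 1 := by linarith
  have hq0 : 0 < q := by rw [hq]; positivity
  have hb0 : 0 < b := by rw [hb]; positivity
  have hqb : q = b + 1 + r := by rw [hq, hb]; ring
  have hKN : ∫ t in Ioi (0 : ℝ), (1 + t ^ r) ^ (-(q / r))
      = b * ∫ t in Ioi (0 : ℝ), t ^ r * (1 + t ^ r) ^ (-(q / r)) := by
    have := integral_one_add_rpow_rpow hr hb0
    rwa [← hqb] at this
  have hKi : IntegrableOn (fun t : ℝ => (1 + t ^ r) ^ (-(q / r))) (Ioi 0) :=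
    integrableOn_one_add_rpow_rpow hr (by linarith)
  have hvi : IntegrableOn (fun t : ℝ => t ^ r * (1 + t ^ r) ^ (-(q / r))) (Ioi 0) :=
    integrableOn_rpow_mul_one_add_rpow_rpow hr (by linarith)
  have hσ := measurable_ballVolume hn
  set g : ℝ → ℝ≥0∞ := fun t => ENNReal.ofReal ((1 + t ^ r) ^ (-((1 + r) / r))) with hg
  have hgm : Measurable g := by fun_prop
  have hm : ∀ s, 0 < s → (volume.withDensity fun x : EuclideanSpace ℝ (Fin n) =>
      g (ballVolume x)).map ballVolume (Iio s) = ENNReal.ofReal (s * (1 + s ^ r) ^ (-(1 / r))) := by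
    intro s hs
    rw [Measure.map_apply hσ measurableSet_Iio, withDensity_apply _ (hσ measurableSet_Iio),
      ← setLIntegral_map measurableSet_Iio hgm hσ, map_ballVolume hn,
      Measure.restrict_restrict measurableSet_Iio, inter_comm, Ioi_inter_Iio,
      lintegral_Ioo_extremal hr hs]
  have hL : ∫⁻ x : EuclideanSpace ℝ (Fin n), fracHardy n β (fun x => g (ballVolume x)) x ^ q =
      ENNReal.ofReal (∫ t in Ioi (0 : ℝ), t ^ r * (1 + t ^ r) ^ (-(q / r))) := by
    rw [lintegral_fracHardy_rpow hn β hq0, ← hrβ, ofReal_integral_eq_lintegral_ofReal hvi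
      ((ae_restrict_mem measurableSet_Ioi).mono fun t (ht : 0 < t) => by positivity)]
    refine setLIntegral_congr_fun measurableSet_Ioi fun s hs => ?_
    have hs' : 0 < s := hs
    rw [hm s hs, ENNReal.ofReal_rpow_of_nonneg (by positivity) hq0.le, ← ENNReal.ofReal_mul
      (by positivity), Real.mul_rpow (by positivity) (by positivity), ← mul_assoc,
      ← Real.rpow_add hs', sub_add_cancel, ← Real.rpow_mul (by positivity)]
    congr 3
    ring
  have hR : ∫⁻ x : EuclideanSpace ℝ (Fin n), g (ballVolume x) ^ p =
      ENNReal.ofReal (∫ t in Ioi (0 : ℝ), (1 + t ^ r) ^ (-(q / r))) := by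
    rw [lintegral_comp_ballVolume hn (hgm.pow_const p), ofReal_integral_eq_lintegral_ofReal hKi
      ((ae_restrict_mem measurableSet_Ioi).mono fun t (ht : 0 < t) => by positivity)]
    refine setLIntegral_congr_fun measurableSet_Ioi fun s hs => ?_
    have hs' : 0 < s := hs
    simp only [hg]
    rw [ENNReal.ofReal_rpow_of_nonneg (by positivity) hp0.le, ← Real.rpow_mul (by positivity)]
    congr 2
    rw [hq]; ring
  have key := hC _ (hgm.comp hσ)
  simp only [Function.comp_def] at key
  rw [hL, hR, hKN] at key
  rw [hKN]
  have hN : 0 < ∫ t in Ioi (0 : ℝ), t ^ r * (1 + t ^ r) ^ (-(q / r)) := by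
    rw [setIntegral_pos_iff_support_of_nonneg_ae
      ((ae_restrict_mem measurableSet_Ioi).mono fun s (hs : 0 < s) => by positivity) hvi]
    have : Function.support (fun t : ℝ => t ^ r * (1 + t ^ r) ^ (-(q / r))) ∩ Ioi 0 = Ioi 0 :=
      inter_eq_right.2 fun s (hs : 0 < s) => by
        rw [Function.mem_support]; positivity
    rw [this, Real.volume_Ioi]; exact ENNReal.zero_lt_top
  set N := ∫ t in Ioi (0 : ℝ), t ^ r * (1 + t ^ r) ^ (-(q / r))
  have hK : 0 < b * N := by positivity
  calc ENNReal.ofReal (b ^ (-(1 / q)) * (b * N) ^ (-(r / q)))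
      = ENNReal.ofReal N ^ (1 / q) * ENNReal.ofReal ((b * N) ^ (-(1 / p))) := by
        rw [ENNReal.ofReal_rpow_of_pos hN, ← ENNReal.ofReal_mul (by positivity)]
        congr 1
        have e5 : 1 / p = 1 / q + r / q := by rw [hq]; field_simp
        rw [e5, Real.mul_rpow hb0.le hN.le, Real.mul_rpow hb0.le hN.le, neg_add,
          Real.rpow_add hb0, Real.rpow_add hN]
        have : N ^ (1 / q) * N ^ (-(1 / q)) = 1 := by
          rw [← Real.rpow_add hN, add_neg_cancel, Real.rpow_zero]
        calc _ = (N ^ (1 / q) * N ^ (-(1 / q))) *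
              (b ^ (-(1 / q)) * (b ^ (-(r / q)) * N ^ (-(r / q)))) := by rw [this, one_mul]
          _ = _ := by ring
    _ ≤ C * ENNReal.ofReal (b * N) ^ (1 / p) * ENNReal.ofReal ((b * N) ^ (-(1 / p))) := by
        gcongr
    _ = C := by
        rw [ENNReal.ofReal_rpow_of_pos hK, mul_assoc, ← ENNReal.ofReal_mul (by positivity),
          ← Real.rpow_add hK, add_neg_cancel, Real.rpow_zero, ENNReal.ofReal_one, mul_one]

end Euclidean

end Auxiliary

/-- Sharp bound for the fractional Hardy operator `ℍ_β : L^p(ℝⁿ) → L^q(ℝⁿ)`. -/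
theorem fracHardy_sharp (n : ℕ) (hn : 1 ≤ n) (β p q : ℝ)
    (hβ0 : 0 < β) (hβn : β < n) (hp : 1 < p) (hpq : p < q)
    (hscal : 1 / q = 1 / p - β / n) :
    (∀ f : EuclideanSpace ℝ (Fin n) → ℝ≥0∞, Measurable f →
      (∫⁻ x, fracHardy n β f x ^ q) ^ (1 / q)
        ≤ ENNReal.ofReal (((p / (p - 1)) / q) ^ (1 / q) *
            ((n / (q * β)) * betaFn (n / (q * β)) (n / ((q / (q - 1)) * β))) ^ (-β / n)) *
          (∫⁻ x, f x ^ p) ^ (1 / p)) ∧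
    (∀ C : ℝ≥0∞,
      (∀ f : EuclideanSpace ℝ (Fin n) → ℝ≥0∞, Measurable f →
        (∫⁻ x, fracHardy n β f x ^ q) ^ (1 / q) ≤ C * (∫⁻ x, f x ^ p) ^ (1 / p)) →
      ENNReal.ofReal (((p / (p - 1)) / q) ^ (1 / q) *
          ((n / (q * β)) * betaFn (n / (q * β)) (n / ((q / (q - 1)) * β))) ^ (-β / n)) ≤ C) := by
  have hn0 : (0 : ℝ) < n := by exact_mod_cast hn
  have hp0 : 0 < p := by linarith
  have hp1 : 0 < p - 1 := by linarith
  have hq0 : 0 < q := by linarith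
  have hq1 : 0 < q - 1 := by linarith
  set r := q * β / n with hrβ
  have hr : 0 < r := by positivity
  have hq : q = p * (1 + r) := by
    have h1 : β / n = r / q := by rw [hrβ]; field_simp
    rw [h1] at hscal
    field_simp at hscal
    linarith
  have hconst : ((p / (p - 1)) / q) ^ (1 / q) *
      ((n / (q * β)) * betaFn (n / (q * β)) (n / ((q / (q - 1)) * β))) ^ (-β / n) =
      ((p - 1) * (1 + r)) ^ (-(1 / q)) *
        (∫ t in Ioi (0 : ℝ), (1 + t ^ r) ^ (-(q / r))) ^ (-(r / q)) := by
    have e1 : (n : ℝ) / (q * β) = 1 / r := by rw [hrβ]; field_simp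
    have e2 : (n : ℝ) / ((q / (q - 1)) * β) = (q - 1) / r := by rw [hrβ]; field_simp
    have e3 : -β / n = -(r / q) := by rw [hrβ]; field_simp
    have e4 : (p / (p - 1)) / q = ((p - 1) * (1 + r))⁻¹ := by
      have : (p / (p - 1)) / (p * (1 + r)) = ((p - 1) * (1 + r))⁻¹ := by field_simp
      rwa [← hq] at this
    rw [e1, e2, e3, e4, integral_one_add_rpow_rpow_eq_betaFn hr, Real.inv_rpow (by positivity),
      ← Real.rpow_neg (by positivity)]
  rw [hconst]
  exact ⟨fun f hf => lintegral_fracHardy_rpow_le hn hp hr hrβ hq rfl hf,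
    fun C hC => le_of_fracHardy_bound hn hp hr hrβ hq rfl hC⟩
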